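/- The infimum over ρ ∈ (0, ρ̄] of ρ·log(1/p₁) + ρ·I(−d(ρ)/ρ) is a finite, strictly positive real number. -/

import Mathlib

open MeasureTheory Filter Set Topology

open scoped Classical in
/-- Cumulant generating function valued in `EReal` (equal to `+∞` where the
moment generating function is infinite). -/
noncomputable def cgfE {Ω : Type*} [MeasurableSpace Ω] (μ : Measure Ω) (X : Ω → ℝ) (t : ℝ) :
    EReal :=
  if Integrable (fun ω => Real.exp (t * X ω)) μ then
    ((Real.log (∫ ω, Real.exp (t * X ω) ∂μ) : ℝ) : EReal)
  else ⊤

/-- Real-valued version of the cumulant generating function (meaningful where the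
moment generating function is finite). -/
noncomputable def cgfR {Ω : Type*} [MeasurableSpace Ω] (μ : Measure Ω) (X : Ω → ℝ) (t : ℝ) :
    ℝ :=
  Real.log (∫ ω, Real.exp (t * X ω) ∂μ)

/-- The Cramér (Legendre) rate function `I(x) = sup_t (t x - Λ(t))`, valued in `[0,∞]`. -/
noncomputable def rateI {Ω : Type*} [MeasurableSpace Ω] (μ : Measure Ω) (X : Ω → ℝ) (x : ℝ) :
    EReal :=
  ⨆ t : ℝ, (((t * x : ℝ) : EReal) - cgfE μ X t)

/-- `λ* = sup {λ ≥ 0 : E[exp(λ X)] < ∞}`, valued in `EReal`. -/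
noncomputable def lamStar {Ω : Type*} [MeasurableSpace Ω] (μ : Measure Ω) (X : Ω → ℝ) :
    EReal :=
  sSup {l : EReal | ∃ lr : ℝ, l = (lr : EReal) ∧ 0 ≤ lr ∧
    Integrable (fun ω => Real.exp (lr * X ω)) μ}

/-- `x* = sup {x ≥ 0 : I(x) ≤ log m}`. -/
noncomputable def xStar {Ω : Type*} [MeasurableSpace Ω] (μ : Measure Ω) (X : Ω → ℝ)
    (m : ℝ) : ℝ :=
  sSup {x : ℝ | 0 ≤ x ∧ rateI μ X x ≤ ((Real.log m : ℝ) : EReal)}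

/-- `f(ρ) = log m − I(θx*/(1−ρ)) − a/(1−ρ)`, valued in `[-∞,∞)`. -/
noncomputable def fF {Ω : Type*} [MeasurableSpace Ω] (μ : Measure Ω) (X : Ω → ℝ)
    (m θ a ρ : ℝ) : EReal :=
  ((Real.log m : ℝ) : EReal) - rateI μ X (θ * xStar μ X m / (1 - ρ)) -
    ((a / (1 - ρ) : ℝ) : EReal)

/-- `ρ̄ = sup {ρ ∈ (0,1) : f(ρ) ≥ 0}`. -/
noncomputable def rhoBar {Ω : Type*} [MeasurableSpace Ω] (μ : Measure Ω) (X : Ω → ℝ)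
    (m θ a : ℝ) : ℝ :=
  sSup {ρ : ℝ | 0 < ρ ∧ ρ < 1 ∧ 0 ≤ fF μ X m θ a ρ}

/-- `g_ρ(h) = log m − I((h + θx*)/(1−ρ)) − a/(1−ρ)`, valued in `[-∞,∞)`.
(For `ρ = 0` this is the convention `g_0(h) = log m − I(h + θx*) − a`.) -/
noncomputable def gG {Ω : Type*} [MeasurableSpace Ω] (μ : Measure Ω) (X : Ω → ℝ)
    (m θ a ρ h : ℝ) : EReal :=
  ((Real.log m : ℝ) : EReal) - rateI μ X ((h + θ * xStar μ X m) / (1 - ρ)) -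
    ((a / (1 - ρ) : ℝ) : EReal)

/-- `d(ρ) = sup {h ≥ 0 : g_ρ(h) ≥ 0}`. -/
noncomputable def dD {Ω : Type*} [MeasurableSpace Ω] (μ : Measure Ω) (X : Ω → ℝ)
    (m θ a ρ : ℝ) : ℝ :=
  sSup {h : ℝ | 0 ≤ h ∧ 0 ≤ gG μ X m θ a ρ h}

section RateFunction

variable {Ω : Type*} [MeasurableSpace Ω] {μ : Measure Ω} {X : Ω → ℝ}

theorem EReal.zero_le_coe_sub_sub_coe_iff (L b : ℝ) (I : EReal) :
    0 ≤ (L : EReal) - I - (b : EReal) ↔ I ≤ ((L - b : ℝ) : EReal) := by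
  induction I with
  | bot => simp
  | top => simp [-EReal.coe_sub]
  | coe r => norm_cast; constructor <;> intro h <;> linarith

theorem rateI_le_coe_iff {x c : ℝ} :
    rateI μ X x ≤ (c : EReal) ↔
      ∀ t : ℝ, Integrable (fun ω => Real.exp (t * X ω)) μ → t * x - cgfR μ X t ≤ c := by
  rw [rateI, iSup_le_iff]
  refine forall_congr' fun t => ?_
  by_cases h : Integrable (fun ω => Real.exp (t * X ω)) μ
  · rw [cgfE, if_pos h, ← cgfR, ← EReal.coe_sub, EReal.coe_le_coe_iff]
    simp [h]
  · rw [cgfE, if_neg h]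
    simp [h]

theorem coe_le_rateI {t : ℝ} (ht : Integrable (fun ω => Real.exp (t * X ω)) μ) (x : ℝ) :
    ((t * x - cgfR μ X t : ℝ) : EReal) ≤ rateI μ X x := by
  refine le_iSup_of_le t ?_
  rw [cgfE, if_pos ht, ← cgfR, ← EReal.coe_sub]

theorem rateI_convex_le {x y c d s : ℝ} (hs0 : 0 ≤ s) (hs1 : s ≤ 1)
    (hx : rateI μ X x ≤ (c : EReal)) (hy : rateI μ X y ≤ (d : EReal)) :
    rateI μ X ((1 - s) * x + s * y) ≤ (((1 - s) * c + s * d : ℝ) : EReal) := by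
  rw [rateI_le_coe_iff] at *
  intro t ht
  linarith [mul_le_mul_of_nonneg_left (hx t ht) (sub_nonneg.2 hs1),
    mul_le_mul_of_nonneg_left (hy t ht) hs0]

variable [IsProbabilityMeasure μ]

theorem cgfR_zero : cgfR μ X 0 = 0 := by simp [cgfR]

theorem rateI_nonneg (x : ℝ) : 0 ≤ rateI μ X x := by
  have h := coe_le_rateI (μ := μ) (X := X) (t := 0) (by simp) x
  simpa [cgfR_zero] using h

theorem cgfR_nonneg (hint : Integrable X μ) (hmean : ∫ ω, X ω ∂μ = 0) {t : ℝ}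
    (ht : Integrable (fun ω => Real.exp (t * X ω)) μ) : 0 ≤ cgfR μ X t := by
  refine Real.log_nonneg ?_
  have h : ∫ ω, (t * X ω + 1) ∂μ ≤ ∫ ω, Real.exp (t * X ω) ∂μ :=
    integral_mono ((hint.const_mul t).add (integrable_const 1)) ht
      fun ω => Real.add_one_le_exp _
  rw [integral_add (hint.const_mul t) (integrable_const 1), integral_const_mul, hmean] at h
  simpa using h

theorem rateI_zero (hint : Integrable X μ) (hmean : ∫ ω, X ω ∂μ = 0) : rateI μ X 0 = 0 := by
  refine le_antisymm ?_ (rateI_nonneg 0)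
  rw [← EReal.coe_zero, rateI_le_coe_iff]
  intro t ht
  linarith [cgfR_nonneg hint hmean ht]

theorem rateI_mono (hint : Integrable X μ) (hmean : ∫ ω, X ω ∂μ = 0) {x y c : ℝ}
    (hx : 0 ≤ x) (hxy : x ≤ y) (hy : rateI μ X y ≤ (c : EReal)) :
    rateI μ X x ≤ (c : EReal) := by
  have hc : 0 ≤ c := by exact_mod_cast (rateI_nonneg y).trans hy
  rw [rateI_le_coe_iff] at hy ⊢
  intro t ht
  have h1 := hy t ht
  have h2 := cgfR_nonneg hint hmean ht
  rcases le_total 0 t with h | h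
  · linarith [mul_le_mul_of_nonneg_left hxy h]
  · linarith [mul_nonpos_of_nonpos_of_nonneg h hx]

theorem rateI_pos (hmean : ∫ ω, X ω ∂μ = 0)
    {κ κ' : ℝ} (hκ : 0 < κ) (hκi : Integrable (fun ω => Real.exp (κ * X ω)) μ)
    (hκ' : κ' < 0) (hκi' : Integrable (fun ω => Real.exp (κ' * X ω)) μ)
    {y : ℝ} (hy : 0 < y) : 0 < rateI μ X y := by
  by_contra! hle
  rw [← EReal.coe_zero, rateI_le_coe_iff] at hle
  have hcc : Icc κ' κ ⊆ ProbabilityTheory.integrableExpSet X μ :=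
    ProbabilityTheory.convex_integrableExpSet.ordConnected.out hκi' hκi
  have h0 : (0 : ℝ) ∈ interior (ProbabilityTheory.integrableExpSet X μ) :=
    interior_mono hcc (by rw [interior_Icc]; exact ⟨hκ', hκ⟩)
  have hd : HasDerivAt (ProbabilityTheory.cgf X μ) 0 0 := by
    have h := (ProbabilityTheory.analyticAt_cgf h0).differentiableAt.hasDerivAt
    rwa [ProbabilityTheory.deriv_cgf_zero h0, hmean, zero_div] at h
  have hsl := hd.tendsto_slope_zero_right
  refine hy.not_ge (ge_of_tendsto hsl ?_)
  filter_upwards [Ioc_mem_nhdsGT hκ] with t ht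
  have h1 : t * y - ProbabilityTheory.cgf X μ t ≤ 0 := hle t (hcc ⟨hκ'.le.trans ht.1.le, ht.2⟩)
  simp only [zero_add, ProbabilityTheory.cgf_zero, sub_zero, smul_eq_mul]
  rw [← div_eq_inv_mul, le_div_iff₀ ht.1]
  linarith

end RateFunction

section Speed

variable {Ω : Type*} [MeasurableSpace Ω] {μ : Measure Ω} {X : Ω → ℝ} {m θ a : ℝ}

theorem gG_nonneg_iff {ρ h : ℝ} :
    0 ≤ gG μ X m θ a ρ h ↔
      rateI μ X ((h + θ * xStar μ X m) / (1 - ρ)) ≤ ((Real.log m - a / (1 - ρ) : ℝ) : EReal) :=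
  EReal.zero_le_coe_sub_sub_coe_iff _ _ _

theorem fF_nonneg_iff {ρ : ℝ} :
    0 ≤ fF μ X m θ a ρ ↔
      rateI μ X (θ * xStar μ X m / (1 - ρ)) ≤ ((Real.log m - a / (1 - ρ) : ℝ) : EReal) :=
  EReal.zero_le_coe_sub_sub_coe_iff _ _ _

theorem le_xStar (hxB : BddAbove {x : ℝ | 0 ≤ x ∧ rateI μ X x ≤ ((Real.log m : ℝ) : EReal)})
    (ha0 : 0 ≤ a) {x ρ : ℝ} (hρ : ρ < 1) (hx : 0 ≤ x)
    (h : rateI μ X x ≤ ((Real.log m - a / (1 - ρ) : ℝ) : EReal)) : x ≤ xStar μ X m := by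
  refine le_csSup hxB ⟨hx, h.trans ?_⟩
  have : 0 ≤ a / (1 - ρ) := div_nonneg ha0 (by linarith)
  exact_mod_cast (by linarith : Real.log m - a / (1 - ρ) ≤ Real.log m)

theorem le_dD (hxB : BddAbove {x : ℝ | 0 ≤ x ∧ rateI μ X x ≤ ((Real.log m : ℝ) : EReal)})
    (ha0 : 0 ≤ a) (hb : 0 ≤ θ * xStar μ X m) {ρ h : ℝ} (hρ : ρ < 1) (hh : 0 ≤ h)
    (hg : 0 ≤ gG μ X m θ a ρ h) : h ≤ dD μ X m θ a ρ := by
  refine le_csSup ⟨xStar μ X m * (1 - ρ), ?_⟩ ⟨hh, hg⟩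
  rintro k ⟨hk, hgk⟩
  have hp : 0 < 1 - ρ := by linarith
  have := le_xStar hxB ha0 hρ (by positivity) (gG_nonneg_iff.1 hgk)
  rw [div_le_iff₀ hp] at this
  linarith

theorem le_rhoBar {ρ : ℝ} (hρ0 : 0 < ρ) (hρ1 : ρ < 1) (hf : 0 ≤ fF μ X m θ a ρ) :
    ρ ≤ rhoBar μ X m θ a :=
  le_csSup ⟨1, fun _ h => h.2.1.le⟩ ⟨hρ0, hρ1, hf⟩

variable [IsProbabilityMeasure μ]

theorem eventually_gG_nonneg (hint : Integrable X μ) (hmean : ∫ ω, X ω ∂μ = 0)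
    (hθ0 : 0 ≤ θ) (hθ1 : θ < 1)
    (ha : (a : EReal) < ((Real.log m : ℝ) : EReal) - rateI μ X (θ * xStar μ X m))
    (hxpos : 0 < xStar μ X m) :
    ∃ h > 0, ∀ᶠ ρ in 𝓝[>] (0 : ℝ), 0 ≤ gG μ X m θ a ρ h := by
  have hb : 0 ≤ θ * xStar μ X m := by positivity
  have hb1 : θ * xStar μ X m < xStar μ X m := by nlinarith
  have hI : rateI μ X (θ * xStar μ X m) < ((Real.log m - a : ℝ) : EReal) := by
    generalize rateI μ X (θ * xStar μ X m) = I at ha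
    induction I with
    | bot => exact EReal.bot_lt_coe _
    | top => simp at ha
    | coe r => norm_cast at ha ⊢; linarith
  obtain ⟨c, hbc, hc⟩ := EReal.lt_iff_exists_real_btwn.1 hI
  rw [EReal.coe_lt_coe_iff] at hc
  have hne : {x : ℝ | 0 ≤ x ∧ rateI μ X x ≤ ((Real.log m : ℝ) : EReal)}.Nonempty := by
    by_contra hne
    rw [not_nonempty_iff_eq_empty] at hne
    simp [xStar, hne] at hxpos
  obtain ⟨y, ⟨-, hyI⟩, hby⟩ := exists_lt_of_lt_csSup hne hb1
  obtain ⟨s, hs, hs0, hs1⟩ : ∃ s : ℝ,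
      (1 - s) * c + s * Real.log m < Real.log m - a ∧ 0 < s ∧ s ≤ 1 := by
    have h1 : ∀ᶠ s in 𝓝[>] (0 : ℝ), (1 - s) * c + s * Real.log m < Real.log m - a := by
      have hcont : Continuous fun s : ℝ => (1 - s) * c + s * Real.log m := by fun_prop
      exact (hcont.continuousWithinAt (s := Ioi 0) (x := 0)).eventually_lt_const
        (by simpa using hc)
    obtain ⟨s, h1, h2⟩ := (h1.and (Ioc_mem_nhdsGT one_pos)).exists
    exact ⟨s, h1, h2⟩
  have hz := rateI_convex_le hs0.le hs1 hbc.le hyI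
  set b := θ * xStar μ X m
  set z := (1 - s) * b + s * y
  set e := (1 - s) * c + s * Real.log m
  have hbz : b < z := by nlinarith
  refine ⟨(z - b) / 2, by linarith, ?_⟩
  have h1 : ∀ᶠ ρ in 𝓝[>] (0 : ℝ), ((z - b) / 2 + b) / (1 - ρ) < z := by
    have hcont : ContinuousAt (fun ρ : ℝ => ((z - b) / 2 + b) / (1 - ρ)) 0 :=
      ContinuousAt.div (by fun_prop) (by fun_prop) (by norm_num)
    refine hcont.continuousWithinAt.eventually_lt_const ?_
    simp only [sub_zero, div_one]
    linarith
  have h2 : ∀ᶠ ρ in 𝓝[>] (0 : ℝ), a / (1 - ρ) < Real.log m - e := by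
    have hcont : ContinuousAt (fun ρ : ℝ => a / (1 - ρ)) 0 :=
      ContinuousAt.div (by fun_prop) (by fun_prop) (by norm_num)
    refine hcont.continuousWithinAt.eventually_lt_const ?_
    simp only [sub_zero, div_one]
    linarith
  filter_upwards [h1, h2, Ioo_mem_nhdsGT one_pos] with ρ h1 h2 h3
  rw [gG_nonneg_iff]
  have hp : 0 < 1 - ρ := by linarith [h3.2]
  refine (rateI_mono hint hmean (div_nonneg (by linarith) hp.le) h1.le hz).trans ?_
  exact_mod_cast (by linarith : e ≤ Real.log m - a / (1 - ρ))

theorem fF_nonneg_of_gG_nonneg (hint : Integrable X μ) (hmean : ∫ ω, X ω ∂μ = 0)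
    (hb : 0 ≤ θ * xStar μ X m) {ρ h : ℝ} (hρ : ρ < 1) (hh : 0 ≤ h)
    (hg : 0 ≤ gG μ X m θ a ρ h) : 0 ≤ fF μ X m θ a ρ := by
  have hp : 0 < 1 - ρ := by linarith
  rw [gG_nonneg_iff] at hg
  rw [fF_nonneg_iff]
  exact rateI_mono hint hmean (by positivity) (by gcongr; linarith) hg

theorem rhoBar_lt_one (hm : 1 < m) (ha0 : 0 ≤ a) (hpos : 0 < θ ∨ 0 < a)
    (hxB : BddAbove {x : ℝ | 0 ≤ x ∧ rateI μ X x ≤ ((Real.log m : ℝ) : EReal)})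
    (hxpos : 0 < xStar μ X m) : rhoBar μ X m θ a < 1 := by
  have hL := Real.log_pos hm
  obtain ⟨r, hr0, hr1, hr⟩ : ∃ r : ℝ, 0 ≤ r ∧ r < 1 ∧
      ∀ ρ, 0 < ρ → ρ < 1 → 0 ≤ fF μ X m θ a ρ → ρ ≤ r := by
    rcases hpos with h | h
    · refine ⟨max 0 (1 - θ), le_max_left _ _, by simpa using h, fun ρ _ h1 hf => ?_⟩
      have hp : 0 < 1 - ρ := by linarith
      have := le_xStar hxB ha0 h1 (by positivity) (fF_nonneg_iff.1 hf)
      rw [div_le_iff₀ hp] at this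
      exact le_max_of_le_right (by nlinarith)
    · refine ⟨max 0 (1 - a / Real.log m), le_max_left _ _, ?_, fun ρ _ h1 hf => ?_⟩
      · have := div_pos h hL
        simpa using this
      · have hp : 0 < 1 - ρ := by linarith
        have h2 : (0 : ℝ) ≤ Real.log m - a / (1 - ρ) := by
          exact_mod_cast (rateI_nonneg _).trans (fF_nonneg_iff.1 hf)
        have h3 : a ≤ Real.log m * (1 - ρ) := by
          rw [← div_le_iff₀ hp]; linarith
        refine le_max_of_le_right ?_
        have h4 : a / Real.log m ≤ 1 - ρ := by
          rw [div_le_iff₀ hL]; linarith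
        linarith
  exact (Real.sSup_le (fun ρ h => hr ρ h.1 h.2.1 h.2.2) hr0).trans_lt hr1

theorem dD_rhoBar (hint : Integrable X μ) (hmean : ∫ ω, X ω ∂μ = 0)
    {κ κ' : ℝ} (hκ : 0 < κ) (hκi : Integrable (fun ω => Real.exp (κ * X ω)) μ)
    (hκ' : κ' < 0) (hκi' : Integrable (fun ω => Real.exp (κ' * X ω)) μ)
    (hm : 1 < m) (hθ0 : 0 ≤ θ) (ha0 : 0 ≤ a)
    (hxB : BddAbove {x : ℝ | 0 ≤ x ∧ rateI μ X x ≤ ((Real.log m : ℝ) : EReal)})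
    (hxpos : 0 < xStar μ X m) (hρ : 0 < rhoBar μ X m θ a) :
    dD μ X m θ a (rhoBar μ X m θ a) = 0 := by
  have hL := Real.log_pos hm
  by_cases hpos : 0 < θ ∨ 0 < a
  · have hρ1 := rhoBar_lt_one hm ha0 hpos hxB hxpos
    have hb : 0 ≤ θ * xStar μ X m := by positivity
    refine le_antisymm (Real.sSup_nonpos ?_) (Real.sSup_nonneg fun h hh => hh.1)
    rintro h ⟨-, hg⟩
    by_contra! hh
    rw [gG_nonneg_iff] at hg
    set r := rhoBar μ X m θ a
    set b := θ * xStar μ X m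
    have hp : 0 < 1 - r := by linarith
    have hc : 0 < Real.log m - a / (1 - r) := by
      exact_mod_cast (rateI_pos hmean hκ hκi hκ' hκi' (by positivity)).trans_le hg
    set c := Real.log m - a / (1 - r) with hcdef
    have hlt : b / (h + b) < 1 := by rw [div_lt_one (by positivity)]; linarith
    have hcl : ContinuousAt (fun ρ : ℝ => b * (1 - r) / ((1 - ρ) * (h + b))) r :=
      ContinuousAt.div (by fun_prop) (by fun_prop) (by positivity)
    have hca : ContinuousAt (fun ρ : ℝ => a / (1 - ρ)) r :=
      ContinuousAt.div (by fun_prop) (by fun_prop) hp.ne'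
    have hval : b * (1 - r) / ((1 - r) * (h + b)) = b / (h + b) := by
      field_simp
    have h1 : ∀ᶠ ρ in 𝓝[>] r, b * (1 - r) / ((1 - ρ) * (h + b)) < 1 :=
      hcl.continuousWithinAt.eventually_lt_const (by simpa only [hval] using hlt)
    have h2 : ∀ᶠ ρ in 𝓝[>] r,
        b * (1 - r) / ((1 - ρ) * (h + b)) * c + a / (1 - ρ) < Real.log m := by
      refine ((hcl.mul_const c).add hca).continuousWithinAt.eventually_lt_const ?_
      simp only [Pi.add_apply, hval]
      nlinarith
    obtain ⟨ρ, h1, h2, h3, h4⟩ := (h1.and (h2.and (Ioo_mem_nhdsGT hρ1))).exists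
    have hq : 0 < 1 - ρ := by linarith
    refine h3.not_ge (le_rhoBar (hρ.trans h3) h4 ?_)
    have h0 : rateI μ X 0 ≤ ((0 : ℝ) : EReal) := (rateI_zero hint hmean).le
    have h5 := rateI_convex_le (by positivity) h1.le h0 hg
    rw [fF_nonneg_iff]
    have h6 : (1 - b * (1 - r) / ((1 - ρ) * (h + b))) * 0 +
        b * (1 - r) / ((1 - ρ) * (h + b)) * ((h + b) / (1 - r)) = b / (1 - ρ) := by
      field_simp
      ring
    rw [h6] at h5
    refine h5.trans (EReal.coe_le_coe_iff.2 ?_)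
    linarith
  · push Not at hpos
    obtain rfl : θ = 0 := le_antisymm hpos.1 hθ0
    obtain rfl : a = 0 := le_antisymm hpos.2 ha0
    have hf : ∀ ρ, 0 ≤ fF μ X m 0 0 ρ := fun ρ => by
      rw [fF_nonneg_iff]
      simpa [rateI_zero hint hmean] using hL.le
    have h1 : rhoBar μ X m 0 0 = 1 := by
      refine le_antisymm (Real.sSup_le (fun ρ h => h.2.1.le) zero_le_one) ?_
      refine le_of_forall_lt fun c hc => ?_
      obtain ⟨ρ, h1, h2⟩ := exists_between (max_lt hc one_pos)
      exact ((le_max_left _ _).trans_lt h1).trans_le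
        (le_rhoBar ((le_max_right _ _).trans_lt h1) h2 (hf ρ))
    have hset : {h : ℝ | 0 ≤ h ∧ 0 ≤ gG μ X m 0 0 1 h} = Ici 0 := by
      ext h
      have : 0 ≤ gG μ X m 0 0 1 h := by
        rw [gG_nonneg_iff]
        simpa [rateI_zero hint hmean] using hL.le
      simp [this]
    rw [h1, dD, hset]
    exact Real.sSup_of_not_bddAbove (not_bddAbove_Ici 0)

end Speed

theorem stmt10 {Ω : Type*} [MeasurableSpace Ω] (μ : Measure Ω) [IsProbabilityMeasure μ]
    (X : Ω → ℝ) (hmeas : Measurable X) (hint : Integrable X μ)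
    (hmean : ∫ ω, X ω ∂μ = 0) (hX0 : μ {ω | X ω = 0} < 1)
    (hmom : ∃ κ : ℝ, 0 < κ ∧ Integrable (fun ω => Real.exp (κ * X ω)) μ)
    (hmom' : ∃ κ' : ℝ, κ' < 0 ∧ Integrable (fun ω => Real.exp (κ' * X ω)) μ)
    (m θ a p₁ : ℝ) (hm : 1 < m) (hθ0 : 0 ≤ θ) (hθ1 : θ < 1)
    (hp₁ : 0 < p₁ ∧ p₁ < 1)
    (ha0 : 0 ≤ a) (ha : (a : EReal) < ((Real.log m : ℝ) : EReal) - rateI μ X (θ * xStar μ X m))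
    (hxB : BddAbove {x : ℝ | 0 ≤ x ∧ rateI μ X x ≤ ((Real.log m : ℝ) : EReal)})
    (hxpos : 0 < xStar μ X m) :
    0 < ⨅ ρ ∈ Set.Ioc (0 : ℝ) (rhoBar μ X m θ a),
        (((ρ * Real.log (1 / p₁) : ℝ)) : EReal) +
          (ρ : EReal) * rateI μ X (-(dD μ X m θ a ρ) / ρ) ∧
    (⨅ ρ ∈ Set.Ioc (0 : ℝ) (rhoBar μ X m θ a),
        (((ρ * Real.log (1 / p₁) : ℝ)) : EReal) +
          (ρ : EReal) * rateI μ X (-(dD μ X m θ a ρ) / ρ)) < ⊤ := by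
  obtain ⟨κ, hκ, hκi⟩ := hmom
  obtain ⟨κ', hκ', hκi'⟩ := hmom'
  have hb : 0 ≤ θ * xStar μ X m := by positivity
  have hp : 0 < Real.log (1 / p₁) :=
    Real.log_pos (by rw [one_div]; exact (one_lt_inv₀ hp₁.1).2 hp₁.2)
  obtain ⟨h, hh, hev⟩ := eventually_gG_nonneg hint hmean hθ0 hθ1 ha hxpos
  have hsmall : ∀ᶠ ρ in 𝓝[>] (0 : ℝ), ρ * cgfR μ X κ' < -κ' * h / 2 := by
    have hcont : Continuous fun ρ : ℝ => ρ * cgfR μ X κ' := by fun_prop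
    refine (hcont.continuousWithinAt (s := Ioi 0) (x := 0)).eventually_lt_const ?_
    nlinarith
  obtain ⟨δ, hδ, hsub⟩ := mem_nhdsGT_iff_exists_Ioc_subset.1
    (hev.and (hsmall.and (Ioo_mem_nhdsGT one_pos)))
  rw [mem_Ioi] at hδ
  constructor
  · have hc : 0 < min (δ * Real.log (1 / p₁)) (-κ' * h / 2) :=
      lt_min (by positivity) (by nlinarith)
    refine (EReal.coe_pos.2 hc).trans_le (le_iInf₂ fun ρ hρ => ?_)
    have hρ0 : 0 < ρ := hρ.1
    have hρE : (0 : EReal) ≤ (ρ : EReal) := EReal.coe_nonneg.2 hρ0.le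
    rcases le_total δ ρ with hle | hle
    · refine le_add_of_le_of_nonneg (EReal.coe_le_coe_iff.2 ?_)
        (mul_nonneg hρE (rateI_nonneg _))
      exact (min_le_left _ _).trans (by gcongr)
    · obtain ⟨hg, hs, -, hρ1⟩ := hsub ⟨hρ0, hle⟩
      have hd := le_dD hxB ha0 hb hρ1 hh.le hg
      refine le_trans ?_ (add_le_add_right (mul_le_mul_of_nonneg_left
        (coe_le_rateI hκi' (-(dD μ X m θ a ρ) / ρ)) hρE) _)
      rw [← EReal.coe_mul, ← EReal.coe_add, EReal.coe_le_coe_iff]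
      refine (min_le_right _ _).trans ?_
      have h1 : ρ * (κ' * (-(dD μ X m θ a ρ) / ρ) - cgfR μ X κ') =
          -κ' * dD μ X m θ a ρ - ρ * cgfR μ X κ' := by
        field_simp
      have h2 : -κ' * h ≤ -κ' * dD μ X m θ a ρ :=
        mul_le_mul_of_nonneg_left hd (by linarith)
      have h3 : 0 < ρ * Real.log (1 / p₁) := by positivity
      rw [h1]
      linarith
  · obtain ⟨hg, -, -, hδ1⟩ := hsub ⟨hδ, le_rfl⟩
    have hr : 0 < rhoBar μ X m θ a :=
      hδ.trans_le (le_rhoBar hδ hδ1 (fF_nonneg_of_gG_nonneg hint hmean hb hδ1 hh.le hg))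
    refine (iInf₂_le _ ⟨hr, le_rfl⟩).trans_lt ?_
    rw [dD_rhoBar hint hmean hκ hκi hκ' hκi' hm hθ0 ha0 hxB hxpos hr, neg_zero, zero_div,
      rateI_zero hint hmean, mul_zero, add_zero]
    exact EReal.coe_lt_top _
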